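/- arXiv:quant-ph/0702190 — 2 statements merged into one kernel-verified Lean document; each statement's English description precedes it below -/
import Mathlib

section
/- (Constructive method.) Let n ≥ 1, let g_i = Z^{⊗(i-1)} ⊗ X ⊗ I^{⊗(n-i)} for 1 ≤ i ≤ n, and for a binary string a ∈ {0,1}^n set v_a = g_1^{a_1} g_2^{a_2} ⋯ g_n^{a_n}. Then for each m ∈ {0, 1, n−1, n}, the symmetric basis state |n,m⟩ satisfies ⟨n,m| v_a† v_b |n,m⟩ = δ_{ab} for all a, b ∈ {0,1}^n; i.e., |n,0⟩, |n,1⟩, |n,n−1⟩ and |n,n⟩ are each locally encoded by the family {v_a}, whose members are local unitaries. -/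
open Matrix

/-- Pauli X matrix. -/
noncomputable def Xg : Matrix (Fin 2) (Fin 2) ℂ := !![0, 1; 1, 0]

/-- Pauli Z matrix. -/
noncomputable def Zg : Matrix (Fin 2) (Fin 2) ℂ := !![1, 0; 0, -1]

/-- The `n`-fold tensor (Kronecker) product of single-qubit matrices. -/
noncomputable def tens {n : ℕ} (u : Fin n → Matrix (Fin 2) (Fin 2) ℂ) :
    Matrix (Fin n → Fin 2) (Fin n → Fin 2) ℂ :=
  fun x y => ∏ k, u k (x k) (y k)

/-- A matrix on `(ℂ²)^{⊗n}` is a local unitary if it is an `n`-fold tensor product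
of 2×2 unitary matrices. -/
noncomputable def IsLocalUnitary {n : ℕ}
    (M : Matrix (Fin n → Fin 2) (Fin n → Fin 2) ℂ) : Prop :=
  ∃ u : Fin n → Matrix (Fin 2) (Fin 2) ℂ,
    (∀ k, u k ∈ Matrix.unitaryGroup (Fin 2) ℂ) ∧ M = tens u

/-- `g_i = Z^{⊗(i-1)} ⊗ X ⊗ I^{⊗(n-i)}`. -/
noncomputable def gOp {n : ℕ} (i : Fin n) :
    Matrix (Fin n → Fin 2) (Fin n → Fin 2) ℂ :=
  tens fun k => if k < i then Zg else if k = i then Xg else 1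

/-- The ordered product `v_a = g_1^{a_1} g_2^{a_2} ⋯ g_n^{a_n}`. -/
noncomputable def vEnc {n : ℕ} (a : Fin n → Fin 2) :
    Matrix (Fin n → Fin 2) (Fin n → Fin 2) ℂ :=
  ((List.finRange n).map fun i => gOp i ^ ((a i : ℕ))).prod

/-- The symmetric basis state `|n,m⟩`: the normalized equal-amplitude superposition of
all computational basis states of Hamming weight `m`. -/
noncomputable def symState (n m : ℕ) : (Fin n → Fin 2) → ℂ :=
  fun x => if (∑ k, ((x k : ℕ))) = m then ((1 / Real.sqrt (n.choose m) : ℝ) : ℂ) else 0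

lemma tens_mul' {n : ℕ} (u v : Fin n → Matrix (Fin 2) (Fin 2) ℂ) :
    tens u * tens v = tens (fun k => u k * v k) := by
  ext x y
  simp only [tens, Matrix.mul_apply]
  rw [Finset.prod_univ_sum]
  simp [Finset.prod_mul_distrib]

lemma tens_one' {n : ℕ} : tens (fun _ : Fin n => (1 : Matrix (Fin 2) (Fin 2) ℂ)) = 1 := by
  ext x y
  simp only [tens, Matrix.one_apply]
  by_cases h : x = y
  · subst h; simp
  · rw [if_neg h]
    obtain ⟨k, hk⟩ := Function.ne_iff.mp h
    exact Finset.prod_eq_zero (Finset.mem_univ k) (by simp [hk])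

lemma tens_pow' {n : ℕ} (u : Fin n → Matrix (Fin 2) (Fin 2) ℂ) (e : ℕ) :
    tens u ^ e = tens (fun k => u k ^ e) := by
  induction e with
  | zero => simp [tens_one']
  | succ e ih => rw [pow_succ, ih, tens_mul']; simp only [pow_succ]

lemma tens_conj' {n : ℕ} (u : Fin n → Matrix (Fin 2) (Fin 2) ℂ) :
    (tens u)ᴴ = tens (fun k => (u k)ᴴ) := by
  ext x y
  simp [tens, Matrix.conjTranspose_apply]

lemma tens_list {n : ℕ} (F : Fin n → Fin n → Matrix (Fin 2) (Fin 2) ℂ) (l : List (Fin n)) :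
    (l.map fun i => tens (F i)).prod = tens (fun k => (l.map fun i => F i k).prod) := by
  induction l with
  | nil => simp [tens_one']
  | cons i l ih => simp [ih, tens_mul']

lemma local_list {n : ℕ} (a : Fin n → Fin 2) (k : Fin n) (l : List (Fin n))
    (hl : l.Pairwise (· < ·)) :
    (l.map fun i => (if k < i then Zg else if k = i then Xg else 1) ^ ((a i : ℕ))).prod
      = (if k ∈ l then Xg ^ ((a k : ℕ)) else 1) *
        Zg ^ (l.map fun i => if k < i then (a i : ℕ) else 0).sum := by
  induction l with
  | nil => simp
  | cons i l ih =>
    rw [List.pairwise_cons] at hl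
    have ih := ih hl.2
    simp only [List.map_cons, List.prod_cons, List.sum_cons, ih]
    rcases lt_trichotomy k i with h | h | h
    · have h1 : k ∉ l := fun hk => absurd (hl.1 k hk) (not_lt.mpr h.le)
      have h2 : k ∉ i :: l := by simp [h1, h.ne]
      simp [h, h1, h2, pow_add, h.ne]
    · subst h
      have h1 : k ∉ l := fun hk => absurd (hl.1 k hk) (lt_irrefl _)
      simp [h1]
    · have : ¬ k < i := not_lt.mpr h.le
      simp [this, h.ne']

noncomputable def S {n : ℕ} (a : Fin n → Fin 2) (k : Fin n) : ℕ :=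
  ∑ i, if k < i then (a i : ℕ) else 0

lemma vEnc_eq {n : ℕ} (a : Fin n → Fin 2) :
    vEnc a = tens (fun k => Xg ^ ((a k : ℕ)) * Zg ^ S a k) := by
  unfold vEnc gOp
  simp only [tens_pow']
  rw [tens_list (fun i k => (if k < i then Zg else if k = i then Xg else 1) ^ ((a i : ℕ)))]
  congr 1
  funext k
  rw [local_list a k _ (List.pairwise_lt_finRange n)]
  simp [S, Fin.sum_univ_def]

lemma Zpow (s : ℕ) : Zg ^ s = !![1, 0; 0, (-1) ^ s] := by
  induction s with
  | zero => simp [Matrix.one_fin_two]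
  | succ s ih => rw [pow_succ, ih]; simp [Zg, pow_succ]

lemma X_unit : Xg ∈ Matrix.unitaryGroup (Fin 2) ℂ := by
  rw [Matrix.mem_unitaryGroup_iff]
  ext i j
  fin_cases i <;> fin_cases j <;> simp [Xg, Matrix.star_eq_conjTranspose, Matrix.mul_apply]

lemma Z_unit : Zg ∈ Matrix.unitaryGroup (Fin 2) ℂ := by
  rw [Matrix.mem_unitaryGroup_iff]
  ext i j
  fin_cases i <;> fin_cases j <;> simp [Zg, Matrix.star_eq_conjTranspose, Matrix.mul_apply]

lemma loc_unit (e s : ℕ) : Xg ^ e * Zg ^ s ∈ Matrix.unitaryGroup (Fin 2) ℂ :=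
  mul_mem (pow_mem X_unit e) (pow_mem Z_unit s)

noncomputable def W (α β : Fin 2) (s t : ℕ) : Matrix (Fin 2) (Fin 2) ℂ :=
  (Xg ^ (α : ℕ) * Zg ^ s)ᴴ * (Xg ^ (β : ℕ) * Zg ^ t)

lemma W_ne {α β : Fin 2} (h : α ≠ β) (s t : ℕ) (i j : Fin 2) :
    W α β s t j i = (-1) ^ (s + t) * W α β s t i j := by
  have hs : ((-1 : ℂ) ^ s) * (-1) ^ s = 1 := by rw [← mul_pow]; simp
  have ht : ((-1 : ℂ) ^ t) * (-1) ^ t = 1 := by rw [← mul_pow]; simp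
  unfold W
  rw [Zpow, Zpow]
  fin_cases α <;> fin_cases β <;> first | exact absurd rfl h | skip
  all_goals
    fin_cases i <;> fin_cases j <;>
      simp [Xg, Matrix.mul_apply, pow_add]
  all_goals first
    | linear_combination (-(-1 : ℂ) ^ s) * ht
    | linear_combination (-(-1 : ℂ) ^ t) * hs

lemma W_ne_diag {α β : Fin 2} (h : α ≠ β) (s t : ℕ) (i : Fin 2) : W α β s t i i = 0 := by
  unfold W
  rw [Zpow, Zpow]
  fin_cases α <;> fin_cases β <;> first | exact absurd rfl h | skip
  all_goals
    fin_cases i <;> simp [Xg, Matrix.mul_apply]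

lemma W_eq_off (α : Fin 2) (s t : ℕ) {i j : Fin 2} (h : i ≠ j) : W α α s t i j = 0 := by
  unfold W
  rw [Zpow, Zpow]
  fin_cases i <;> fin_cases j <;> first | exact absurd rfl h | skip
  all_goals
    fin_cases α <;> simp [Xg, Matrix.mul_apply]

lemma W_eq_symm (α : Fin 2) (s t : ℕ) (i j : Fin 2) : W α α s t i j = W α α s t j i := by
  by_cases h : i = j
  · rw [h]
  · rw [W_eq_off _ _ _ h, W_eq_off _ _ _ (Ne.symm h)]

lemma sign_eq {n : ℕ} (a b : Fin n → Fin 2) (p q : Fin n) (hpq : p < q)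
    (hD : ∀ k, a k ≠ b k ↔ k = p ∨ k = q) :
    (-1 : ℂ) ^ (S a p + S b p) = -1 ∧ (-1 : ℂ) ^ (S a q + S b q) = 1 := by
  have key : ∀ k, (-1 : ℂ) ^ (S a k + S b k) =
      ∏ i, if k < i ∧ a i ≠ b i then (-1 : ℂ) else 1 := by
    intro k
    unfold S
    rw [← Finset.sum_add_distrib, ← Finset.prod_pow_eq_pow_sum]
    refine Finset.prod_congr rfl fun i _ => ?_
    by_cases hk : k < i
    · simp only [hk, if_true, true_and]
      generalize a i = α
      generalize b i = β
      fin_cases α <;> fin_cases β <;> simp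
    · simp [hk]
  constructor
  · rw [key, Finset.prod_eq_single q]
    · rw [if_pos ⟨hpq, (hD q).2 (Or.inr rfl)⟩]
    · intro i _ hi
      rw [if_neg]
      rintro ⟨h1, h2⟩
      rcases (hD i).1 h2 with h | h
      · exact h1.ne' h
      · exact hi h
    · simp
  · rw [key]
    refine Finset.prod_eq_one fun i _ => ?_
    rw [if_neg]
    rintro ⟨h1, h2⟩
    rcases (hD i).1 h2 with h | h
    · exact absurd (h ▸ h1) hpq.not_gt
    · exact h1.ne' h

lemma antisymm_aux {n : ℕ} (a b x y : Fin n → Fin 2) (p q : Fin n) (hpq : p < q)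
    (hD : ∀ k, a k ≠ b k ↔ k = p ∨ k = q) :
    tens (fun k => W (a k) (b k) (S a k) (S b k)) y x
      = - tens (fun k => W (a k) (b k) (S a k) (S b k)) x y := by
  obtain ⟨h1, h2⟩ := sign_eq a b p q hpq hD
  have : ∀ k, W (a k) (b k) (S a k) (S b k) (y k) (x k)
      = (if k = p then -1 else 1) * W (a k) (b k) (S a k) (S b k) (x k) (y k) := by
    intro k
    by_cases hk : a k = b k
    · have hp : k ≠ p := fun h => (hD k).2 (Or.inl h) hk
      rw [hk, W_eq_symm, if_neg hp, one_mul]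
    · rw [W_ne hk]
      rcases (hD k).1 hk with h | h
      · rw [h, h1, if_pos rfl]
      · rw [h, h2, if_neg hpq.ne']
  unfold tens
  simp only [this]
  rw [Finset.prod_mul_distrib]
  simp

lemma weight_eq {n : ℕ} (x : Fin n → Fin 2) :
    ∑ k, (x k : ℕ) = (Finset.univ.filter fun k => x k = 1).card := by
  rw [Finset.card_filter]
  refine Finset.sum_congr rfl fun k _ => ?_
  generalize x k = α
  fin_cases α <;> simp

lemma antisymm_main {n m : ℕ} (hn : 1 ≤ n) (hm : m = 0 ∨ m = 1 ∨ m = n - 1 ∨ m = n)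
    (a b x y : Fin n → Fin 2) (hab : a ≠ b)
    (hx : ∑ k, (x k : ℕ) = m) (hy : ∑ k, (y k : ℕ) = m) :
    tens (fun k => W (a k) (b k) (S a k) (S b k)) y x
      = - tens (fun k => W (a k) (b k) (S a k) (S b k)) x y := by
  by_cases hsup : ∀ k, a k ≠ b k ↔ x k ≠ y k
  · rw [weight_eq] at hx hy
    set A := Finset.univ.filter fun k => x k = 1 with hA
    set B := Finset.univ.filter fun k => y k = 1 with hB
    have hc : (A \ B).card = (B \ A).card :=
      Finset.card_sdiff_comm (hx.trans hy.symm)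
    have h1 : (A \ B).card ≤ m := hx ▸ Finset.card_le_card Finset.sdiff_subset
    have h2 : (A \ B).card + B.card ≤ n := by
      rw [← Finset.card_union_of_disjoint Finset.sdiff_disjoint]
      simpa using Finset.card_le_univ ((A \ B) ∪ B)
    have two : ∀ k, x k ≠ y k ↔ k ∈ A \ B ∨ k ∈ B \ A := by
      intro k
      simp only [hA, hB, Finset.mem_sdiff, Finset.mem_filter, Finset.mem_univ, true_and]
      generalize x k = α
      generalize y k = β
      fin_cases α <;> fin_cases β <;> simp
    obtain ⟨k, hk⟩ := Function.ne_iff.mp hab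
    have h3 : 1 ≤ (A \ B).card := by
      rcases (two k).1 ((hsup k).1 hk) with h | h
      · exact Finset.card_pos.2 ⟨k, h⟩
      · rw [hc]; exact Finset.card_pos.2 ⟨k, h⟩
    have h4 : (A \ B).card = 1 := by omega
    obtain ⟨p, hp⟩ := Finset.card_eq_one.1 h4
    obtain ⟨q, hq⟩ := Finset.card_eq_one.1 (hc ▸ h4)
    have hD : ∀ k, a k ≠ b k ↔ k = p ∨ k = q := by
      intro k
      rw [hsup, two, hp, hq, Finset.mem_singleton, Finset.mem_singleton]
    have hne : p ≠ q := by
      rintro rfl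
      have e1 : p ∈ A \ B := by simp [hp]
      have e2 : p ∈ B \ A := by simp [hq]
      exact (Finset.mem_sdiff.1 e2).2 (Finset.mem_sdiff.1 e1).1
    rcases lt_or_gt_of_ne hne with h | h
    · exact antisymm_aux a b x y p q h hD
    · exact antisymm_aux a b x y q p h (fun k => (hD k).trans or_comm)
  · push Not at hsup
    obtain ⟨k, hk⟩ := hsup
    have z : W (a k) (b k) (S a k) (S b k) (y k) (x k) = 0 ∧
        W (a k) (b k) (S a k) (S b k) (x k) (y k) = 0 := by
      rcases hk with ⟨h, h'⟩ | ⟨h, h'⟩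
      · rw [h']; exact ⟨W_ne_diag h _ _ _, W_ne_diag h _ _ _⟩
      · rw [h]; exact ⟨W_eq_off _ _ _ (Ne.symm h'), W_eq_off _ _ _ h'⟩
    unfold tens
    rw [Finset.prod_eq_zero (Finset.mem_univ k) z.1, Finset.prod_eq_zero (Finset.mem_univ k) z.2,
      neg_zero]

lemma prod_eq_tens {n : ℕ} (a b : Fin n → Fin 2) :
    (vEnc a)ᴴ * vEnc b = tens (fun k => W (a k) (b k) (S a k) (S b k)) := by
  rw [vEnc_eq, vEnc_eq, tens_conj', tens_mul']
  rfl

lemma self_prod {n : ℕ} (a : Fin n → Fin 2) : (vEnc a)ᴴ * vEnc a = 1 := by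
  rw [prod_eq_tens, ← tens_one']
  congr 1
  funext k
  exact Matrix.mem_unitaryGroup_iff'.1 (loc_unit _ _)

lemma count_eq (n m : ℕ) :
    (Finset.univ.filter fun x : Fin n → Fin 2 => ∑ k, (x k : ℕ) = m).card = n.choose m := by
  have := Finset.card_powersetCard m (Finset.univ : Finset (Fin n))
  rw [Finset.card_univ, Fintype.card_fin] at this
  rw [← this]
  refine Finset.card_bij' (fun x _ => Finset.univ.filter fun k => x k = 1)
    (fun s _ k => if k ∈ s then 1 else 0) ?_ ?_ ?_ ?_
  · intro x hx
    simpa [Finset.mem_powersetCard, weight_eq] using hx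
  · intro s hs
    simpa [Finset.mem_powersetCard, weight_eq] using hs
  · intro x _
    funext k
    simp only [Finset.mem_filter, Finset.mem_univ, true_and]
    generalize x k = α
    fin_cases α <;> simp
  · intro s _
    ext k
    simp

lemma sym_star (n m : ℕ) : star (symState n m) = symState n m := by
  funext x
  simp only [Pi.star_apply, symState]
  split_ifs
  · exact Complex.conj_ofReal _
  · simp

lemma sym_norm (n m : ℕ) (h : m ≤ n) : symState n m ⬝ᵥ symState n m = 1 := by
  have hpos : (0 : ℝ) < n.choose m := by exact_mod_cast Nat.choose_pos h
  simp only [dotProduct, symState, mul_ite, ite_mul, zero_mul, mul_zero]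
  have : ∀ x : Fin n → Fin 2, (if ∑ k, (x k : ℕ) = m then
      if ∑ k, (x k : ℕ) = m then ((1 / Real.sqrt (n.choose m) : ℝ) : ℂ) *
        ((1 / Real.sqrt (n.choose m) : ℝ) : ℂ) else 0 else 0)
      = if ∑ k, (x k : ℕ) = m then ((1 / (n.choose m) : ℝ) : ℂ) else 0 := by
    intro x
    split_ifs
    · rw [← Complex.ofReal_mul, div_mul_div_comm, Real.mul_self_sqrt hpos.le, one_mul]
    · rfl
  rw [Finset.sum_congr rfl fun x _ => this x, ← Finset.sum_filter, Finset.sum_const, count_eq,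
    nsmul_eq_mul]
  have h0 : ((n.choose m : ℕ) : ℂ) ≠ 0 := by exact_mod_cast (Nat.choose_pos h).ne'
  push_cast
  field_simp

theorem stmt12 (n : ℕ) (hn : 1 ≤ n) (m : ℕ)
    (hm : m = 0 ∨ m = 1 ∨ m = n - 1 ∨ m = n) :
    (∀ a : Fin n → Fin 2, IsLocalUnitary (vEnc a)) ∧
    (∀ a b : Fin n → Fin 2,
      star (symState n m) ⬝ᵥ (((vEnc a)ᴴ * vEnc b) *ᵥ symState n m)
        = if a = b then 1 else 0) := by
  refine ⟨fun a => ⟨_, fun k => loc_unit _ _, vEnc_eq a⟩, fun a b => ?_⟩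
  rw [sym_star]
  by_cases hab : a = b
  · subst hab
    rw [self_prod, Matrix.one_mulVec, if_pos rfl]
    exact sym_norm n m (by omega)
  · rw [if_neg hab, prod_eq_tens]
    set M := tens (fun k => W (a k) (b k) (S a k) (S b k)) with hM
    have e : symState n m ⬝ᵥ (M *ᵥ symState n m)
        = ∑ x, ∑ y, symState n m x * (M x y * symState n m y) := by
      simp only [dotProduct, Matrix.mulVec, Finset.mul_sum]
    have anti : ∀ x y, symState n m x * (M x y * symState n m y)
        = - (symState n m y * (M y x * symState n m x)) := by
      intro x y
      by_cases hx : ∑ k, (x k : ℕ) = m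
      · by_cases hy : ∑ k, (y k : ℕ) = m
        · rw [hM, antisymm_main hn hm a b x y hab hx hy]
          ring
        · simp [symState, hy]
      · simp [symState, hx]
    have e2 : symState n m ⬝ᵥ (M *ᵥ symState n m) = - (symState n m ⬝ᵥ (M *ᵥ symState n m)) := by
      conv_lhs => rw [e, Finset.sum_comm]
      rw [e, ← Finset.sum_neg_distrib]
      refine Finset.sum_congr rfl fun x _ => ?_
      rw [← Finset.sum_neg_distrib]
      exact Finset.sum_congr rfl fun y _ => anti y x
    exact self_eq_neg.1 e2
end

section
/- Let n ≥ 1 and let a_1, …, a_n be real numbers with Σ_{i=1}^n a_i² = 1. Let |Ξ⟩ = Σ_{i=1}^n a_i |e_i⟩, where |e_i⟩ is the computational basis state whose i-th bit is 1 and all other bits are 0. With g_i = Z^{⊗(i-1)} ⊗ X ⊗ I^{⊗(n-i)} and v_a = g_1^{a_1} ⋯ g_n^{a_n} for a ∈ {0,1}^n, one has ⟨Ξ| v_a† v_b |Ξ⟩ = δ_{ab} for all a, b ∈ {0,1}^n; i.e., every such real-weighted superposition of weight-one basis states is locally encoded by the same family {v_a} that encodes the W state. -/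
open Matrix

/-- The computational basis state `|e_i⟩` whose `i`-th bit is `1` and all others `0`. -/
noncomputable def eSingle {n : ℕ} (i : Fin n) : (Fin n → Fin 2) → ℂ :=
  fun x => if x = (fun k => if k = i then 1 else 0) then 1 else 0

lemma gOp_entry {n : ℕ} (i : Fin n) (z y : Fin n → Fin 2) :
    gOp i z y = (∏ j, if j < i then (-1 : ℂ) ^ (y j : ℕ) else 1) *
      (if z = y + Pi.single i 1 then 1 else 0) := by
  have h1 : (if z = y + Pi.single i 1 then (1 : ℂ) else 0)
      = ∏ j, (if z j = y j + (Pi.single i 1 : Fin n → Fin 2) j then (1 : ℂ) else 0) := by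
    rw [Finset.prod_ite_zero]
    simp [funext_iff]
  rw [h1, ← Finset.prod_mul_distrib]
  unfold gOp tens
  refine Finset.prod_congr rfl fun j _ => ?_
  beta_reduce
  generalize z j = p
  generalize y j = q
  rcases lt_trichotomy j i with h | h | h
  · simp only [Pi.single_eq_of_ne h.ne, if_pos h]
    fin_cases p <;> fin_cases q <;> simp [Zg]
  · subst h
    simp only [lt_irrefl, if_false, if_true, Pi.single_eq_same]
    fin_cases p <;> fin_cases q <;> simp [Xg]
  · simp only [Pi.single_eq_of_ne h.ne', if_neg h.not_gt, if_neg h.ne']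
    fin_cases p <;> fin_cases q <;> simp

lemma gOp_single {n : ℕ} (i : Fin n) (y : Fin n → Fin 2) :
    gOp i *ᵥ (Pi.single y 1) = (∏ j, if j < i then (-1 : ℂ) ^ (y j : ℕ) else 1) •
      (Pi.single (y + Pi.single i 1) 1 : (Fin n → Fin 2) → ℂ) := by
  ext z
  rw [Matrix.mulVec_single_one]
  simp only [Matrix.col_apply, gOp_entry, Pi.smul_apply, Pi.single_apply, smul_eq_mul]

lemma list_single {n : ℕ} (a : Fin n → Fin 2) (k : Fin n) (L : List (Fin n))
    (hL : L.Pairwise (· < ·)) :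
    (L.map fun i => gOp i ^ ((a i : ℕ))).prod *ᵥ (Pi.single (Pi.single k 1) 1) =
      (L.map fun i => if k < i then (-1 : ℂ) ^ (a i : ℕ) else 1).prod •
      (Pi.single (Pi.single k 1 + fun j => if j ∈ L then a j else 0) 1 :
        (Fin n → Fin 2) → ℂ) := by
  induction L with
  | nil =>
    simp only [List.map_nil, List.prod_nil, Matrix.one_mulVec, one_smul, List.not_mem_nil,
      if_false]
    congr 1
    ext j
    simp
  | cons i L ih =>
    rw [List.pairwise_cons] at hL
    have hi : i ∉ L := fun h => lt_irrefl _ (hL.1 i h)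
    rw [List.map_cons, List.prod_cons, ← Matrix.mulVec_mulVec, ih hL.2, Matrix.mulVec_smul,
      List.map_cons, List.prod_cons, mul_comm, mul_smul]
    congr 1
    obtain h | h : a i = 0 ∨ a i = 1 := by
      generalize a i = p
      fin_cases p <;> simp
    · have : (fun j => if j ∈ i :: L then a j else 0) = fun j => if j ∈ L then a j else 0 := by
        ext j
        by_cases hj : j = i
        · subst hj; simp [hi, h]
        · simp [hj]
      rw [this, h]
      simp only [Fin.val_zero, pow_zero, Matrix.one_mulVec, ite_self, one_smul]
    · have h2 : (fun j => if j ∈ i :: L then a j else 0) =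
          (fun j => if j ∈ L then a j else 0) + Pi.single i 1 := by
        funext j
        by_cases hj : j = i
        · subst hj; simp [hi, h]
        · simp [hj]
      rw [h2, h, ← add_assoc]
      simp only [Fin.val_one, pow_one]
      rw [gOp_single]
      congr 1
      have h3 : ∀ j, (if j < i then (-1 : ℂ) ^ (((Pi.single k 1 + fun j => if j ∈ L then a j else 0 :
          Fin n → Fin 2) j : Fin 2) : ℕ) else 1) = if j = k then (if k < i then -1 else 1) else 1 := by
        intro j
        by_cases hj : j < i
        · have : j ∉ L := fun h => lt_asymm hj (hL.1 j h)
          by_cases hk : j = k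
          · subst hk; simp [hj, this]
          · simp [hj, this, hk]
        · by_cases hk : j = k
          · subst hk; simp [hj]
          · simp [hj, hk]
      rw [Finset.prod_congr rfl fun j _ => h3 j]
      simp

noncomputable def sgn {n : ℕ} (a : Fin n → Fin 2) (k : Fin n) : ℝ :=
  ∏ i, if k < i then (-1 : ℝ) ^ (a i : ℕ) else 1

lemma vEnc_single {n : ℕ} (a : Fin n → Fin 2) (k : Fin n) :
    vEnc a *ᵥ eSingle k = (sgn a k : ℂ) •
      (Pi.single (Pi.single k 1 + a) 1 : (Fin n → Fin 2) → ℂ) := by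
  have h : eSingle k = (Pi.single (Pi.single k 1) 1 : (Fin n → Fin 2) → ℂ) := by
    ext x
    rw [eSingle, Pi.single_apply]
    congr 1
    apply propext
    simp [funext_iff, Pi.single_apply]
  rw [h, vEnc, list_single _ _ _ (List.pairwise_lt_finRange n), sgn]
  simp only [List.mem_finRange, if_true]
  congr 1
  rw [← List.ofFn_eq_map, List.prod_ofFn]
  push_cast
  refine Finset.prod_congr rfl fun i _ => ?_
  split_ifs <;> simp

lemma sgn_sq {n : ℕ} (a : Fin n → Fin 2) (k : Fin n) : sgn a k * sgn a k = 1 := by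
  rw [sgn, ← Finset.prod_mul_distrib]
  refine Finset.prod_eq_one fun i _ => ?_
  split_ifs
  · rw [← mul_pow]; simp
  · simp

lemma fin2_neg (p : Fin 2) : (-1 : ℝ) ^ ((1 + p : Fin 2) : ℕ) = - (-1) ^ (p : ℕ) := by
  fin_cases p <;> simp

lemma fin2_aux (p : Fin 2) : p + p = 0 := by
  fin_cases p <;> rfl

lemma pi_aux {n : ℕ} (p : Fin n → Fin 2) : p + p = 0 := funext fun _ => fin2_aux _

lemma eq_aux {n : ℕ} {a b s t : Fin n → Fin 2} (h : s + a = t + b) : b = s + t + a := by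
  have : t + (s + a) = (t + t) + b := by rw [h, add_assoc]
  rw [pi_aux, zero_add] at this
  rw [← this]; abel

lemma sgn_lt {n : ℕ} {a b : Fin n → Fin 2} {k l : Fin n} (hkl : k < l)
    (h : b = Pi.single k 1 + Pi.single l 1 + a) :
    sgn a k * sgn b l = - (sgn a l * sgn b k) := by
  have h1 : sgn b l = sgn a l := by
    refine Finset.prod_congr rfl fun i _ => ?_
    split_ifs with hi
    · have : b i = a i := by
        rw [h]; simp [hi.ne', (hkl.trans hi).ne']
      rw [this]
    · rfl
  have h2 : sgn b k = - sgn a k := by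
    unfold sgn
    rw [← Finset.mul_prod_erase _ _ (Finset.mem_univ l),
      ← Finset.mul_prod_erase _ (fun i => if k < i then (-1 : ℝ) ^ (a i : ℕ) else 1)
        (Finset.mem_univ l), ← neg_mul]
    congr 1
    · have : b l = 1 + a l := by rw [h]; simp [hkl.ne']
      simp only [hkl, if_true]
      rw [this, fin2_neg]
    · refine Finset.prod_congr rfl fun i hi => ?_
      split_ifs with hk
      · have : b i = a i := by
          rw [h]; simp [hk.ne', Finset.ne_of_mem_erase hi]
        rw [this]
      · rfl
  rw [h1, h2]; ring

lemma sgn_anti {n : ℕ} {a b : Fin n → Fin 2} (hab : a ≠ b) {k l : Fin n}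
    (h : b = Pi.single k 1 + Pi.single l 1 + a) :
    sgn a k * sgn b l = - (sgn a l * sgn b k) := by
  rcases lt_trichotomy k l with hk | hk | hk
  · exact sgn_lt hk h
  · subst hk
    rw [pi_aux, zero_add] at h
    exact absurd h.symm hab
  · rw [sgn_lt hk (by rw [h]; abel), neg_neg]

/-- Every real-weighted superposition `|Ξ⟩ = Σᵢ aᵢ |e_i⟩` of weight-one basis states
(with `Σ aᵢ² = 1`) is locally encoded by the same family `{v_a}` that encodes the
W state: `⟨Ξ| v_a† v_b |Ξ⟩ = δ_{ab}`. -/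
theorem stmt13 (n : ℕ) (hn : 1 ≤ n) (c : Fin n → ℝ) (hc : ∑ i, (c i) ^ 2 = 1)
    (Ξ : (Fin n → Fin 2) → ℂ) (hΞ : Ξ = ∑ i : Fin n, (c i : ℂ) • eSingle i) :
    ∀ a b : Fin n → Fin 2,
      star Ξ ⬝ᵥ (((vEnc a)ᴴ * vEnc b) *ᵥ Ξ) = if a = b then 1 else 0 := by
  intro a b
  have hv : ∀ a, vEnc a *ᵥ Ξ = ∑ k, ((c k * sgn a k : ℝ) : ℂ) •
      (Pi.single (Pi.single k 1 + a) 1 : (Fin n → Fin 2) → ℂ) := by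
    intro a
    rw [hΞ, Matrix.mulVec_sum]
    refine Finset.sum_congr rfl fun k _ => ?_
    rw [Matrix.mulVec_smul, vEnc_single, smul_smul]
    push_cast
    rfl
  have key : star Ξ ⬝ᵥ (((vEnc a)ᴴ * vEnc b) *ᵥ Ξ) =
      ((∑ k, ∑ l, (c k * sgn a k) * (c l * sgn b l) *
        (if (Pi.single k 1 + a : Fin n → Fin 2) = Pi.single l 1 + b then 1 else 0) : ℝ) : ℂ) := by
    rw [← Matrix.mulVec_mulVec, Matrix.dotProduct_mulVec, ← Matrix.star_mulVec, hv, hv,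
      star_sum, sum_dotProduct]
    push_cast
    refine Finset.sum_congr rfl fun k _ => ?_
    rw [dotProduct_sum]
    refine Finset.sum_congr rfl fun l _ => ?_
    rw [dotProduct_smul, dotProduct_single_one]
    simp only [Pi.star_apply, Pi.smul_apply, Pi.single_apply, smul_eq_mul, eq_comm]
    split_ifs <;> simp [mul_comm]
  rw [key]
  split_ifs with hab
  · subst hab
    rw [show (1 : ℂ) = ((∑ i, (c i) ^ 2 : ℝ) : ℂ) by rw [hc, Complex.ofReal_one]]
    congr 1
    refine Finset.sum_congr rfl fun k _ => ?_
    rw [Finset.sum_eq_single k]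
    · simp only [if_true]
      linear_combination (c k)^2 * sgn_sq a k
    · intro l _ hl
      rw [if_neg, mul_zero]
      intro h
      have := congrFun (add_right_cancel h) l
      simp [hl] at this
    · simp
  · rw [← Complex.ofReal_zero]
    congr 1
    set F : Fin n → Fin n → ℝ := fun k l => (c k * sgn a k) * (c l * sgn b l) *
        (if (Pi.single k 1 + a : Fin n → Fin 2) = Pi.single l 1 + b then 1 else 0) with hF
    have hanti : ∀ k l, F k l = - F l k := by
      intro k l
      simp only [hF]
      by_cases h : (Pi.single k 1 + a : Fin n → Fin 2) = Pi.single l 1 + b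
      · have hb := eq_aux h
        have h' : (Pi.single l 1 + a : Fin n → Fin 2) = Pi.single k 1 + b := by
          rw [hb, ← add_assoc, ← add_assoc, pi_aux, zero_add]
        rw [if_pos h, if_pos h']
        linear_combination (c k * c l) * sgn_anti hab hb
      · have h' : ¬ (Pi.single l 1 + a : Fin n → Fin 2) = Pi.single k 1 + b := by
          intro h'
          apply h
          rw [eq_aux h', ← add_assoc, ← add_assoc, pi_aux, zero_add]
        rw [if_neg h, if_neg h']
        simp
    have hs : ∑ k, ∑ l, F k l = - ∑ k, ∑ l, F k l := by
      conv_lhs => rw [Finset.sum_comm]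
      rw [← Finset.sum_neg_distrib]
      refine Finset.sum_congr rfl fun k _ => ?_
      rw [← Finset.sum_neg_distrib]
      exact Finset.sum_congr rfl fun l _ => hanti l k
    linarith
end
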